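/- Let d ≥ 1, α ∈ [0,1], ρ ∈ (0, 1/2], C_u ≥ 1, M > 0 and L ≥ 0. Let u : ℝ^d → [0,1] be a C³ function with u(x) = 1 for ‖x‖ ≤ ρ/2, u(x) = 0 for ‖x‖ ≥ ρ, and ρ^r·‖D^r u(x)‖ ≤ C_u for all x ∈ ℝ^d and r = 1, 2, 3. Let Λ : ℝ^d → ℝ^d be linear and let f : B̄(0,ρ) → ℝ^d be C² with f(0) = 0 and Df(0) = 0; set F(x) := Λx + f(x) for ‖x‖ ≤ ρ, and assume ‖D²F(x)‖ ≤ M and ‖D²F(x) − D²F(y)‖ ≤ L‖x − y‖^α for all x, y ∈ B̄(0,ρ). Define F̃ : ℝ^d → ℝ^d by F̃(x) := Λx + u(x)f(x) for ‖x‖ ≤ ρ and F̃(x) := Λx for ‖x‖ > ρ. Then F̃ is C² on ℝ^d, F̃(x) = F(x) for all ‖x‖ ≤ ρ/2, and for all x, y ∈ ℝ^d: ‖DF̃(x) − Λ‖ ≤ (3C_u + 1)Mρ, ‖D²F̃(x)‖ ≤ (3C_u + 1)M, and ‖D²F̃(x) − D²F̃(y)‖ ≤ (7C_uM/ρ + L)·‖x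 − y‖^α. -/

import Mathlib

set_option maxHeartbeats 2000000
set_option maxSynthPendingDepth 3
set_option linter.unusedSectionVars false

open Metric

section aux
variable {E F : Type*} [NormedAddCommGroup E] [NormedSpace ℝ E]
  [NormedAddCommGroup F] [NormedSpace ℝ F]

/-- First derivative of `u • f`. -/
noncomputable def cutD1 (u : E → ℝ) (u1 : E → E →L[ℝ] ℝ) (f : E → F) (f1 : E → E →L[ℝ] F)
    (x : E) : E →L[ℝ] F := u x • f1 x + (u1 x).smulRight (f x)

/-- Second derivative of `u • f`. -/
noncomputable def cutD2 (u : E → ℝ) (u1 : E → E →L[ℝ] ℝ) (u2 : E → E →L[ℝ] E →L[ℝ] ℝ)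
    (f : E → F) (f1 : E → E →L[ℝ] F) (f2 : E → E →L[ℝ] E →L[ℝ] F)
    (x : E) : E →L[ℝ] E →L[ℝ] F :=
  (u x • f2 x + (u1 x).smulRight (f1 x)) +
   ((ContinuousLinearMap.precompR E (ContinuousLinearMap.smulRightL ℝ E F)) (u1 x) (f1 x)
    + (ContinuousLinearMap.precompL E (ContinuousLinearMap.smulRightL ℝ E F)) (u2 x) (f x))

lemma cutD2_apply (u : E → ℝ) (u1 : E → E →L[ℝ] ℝ) (u2 : E → E →L[ℝ] E →L[ℝ] ℝ)
    (f : E → F) (f1 : E → E →L[ℝ] F) (f2 : E → E →L[ℝ] E →L[ℝ] F) (x v w : E) :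
    cutD2 u u1 u2 f f1 f2 x v w =
      u x • f2 x v w + u1 x v • f1 x w + (u1 x w • f1 x v + u2 x v w • f x) := by
  simp [cutD2, ContinuousLinearMap.precompL_apply]

lemma hasFDerivAt_glue {ρ : ℝ} (g : E → F) (g' : E → E →L[ℝ] F)
    (h1 : ∀ x ∈ closedBall (0 : E) ρ, HasFDerivWithinAt g (g' x) (closedBall 0 ρ) x)
    (h2 : ∀ x, ρ ≤ ‖x‖ → g x = 0) (h3 : ∀ x, ρ ≤ ‖x‖ → g' x = 0) (x : E) :
    HasFDerivAt g (g' x) x := by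
  have hS : IsClosed {x : E | ρ ≤ ‖x‖} := isClosed_le continuous_const continuous_norm
  have hU : closedBall (0 : E) ρ ∪ {x : E | ρ ≤ ‖x‖} = Set.univ := by
    ext z; simpa using le_total ‖z‖ ρ
  rw [← hasFDerivWithinAt_univ, ← hU]
  refine HasFDerivWithinAt.union ?_ ?_
  · by_cases hx : x ∈ closedBall (0 : E) ρ
    · exact h1 x hx
    · exact HasFDerivWithinAt.of_notMem_closure (by rwa [isClosed_closedBall.closure_eq])
  · by_cases hx : x ∈ {x : E | ρ ≤ ‖x‖}
    · rw [h3 x hx]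
      exact (hasFDerivWithinAt_const (0 : F) x _).congr (fun y hy => h2 y hy) (h2 x hx)
    · exact HasFDerivWithinAt.of_notMem_closure (by rwa [hS.closure_eq])

lemma continuous_glue {ρ : ℝ} (g : E → F) (h1 : ContinuousOn g (closedBall 0 ρ))
    (h2 : ∀ x, ρ ≤ ‖x‖ → g x = 0) : Continuous g := by
  have hS : IsClosed {x : E | ρ ≤ ‖x‖} := isClosed_le continuous_const continuous_norm
  have hU : closedBall (0 : E) ρ ∪ {x : E | ρ ≤ ‖x‖} = Set.univ := by
    ext z; simpa using le_total ‖z‖ ρ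
  rw [← continuousOn_univ, ← hU]
  exact h1.union_of_isClosed ((continuousOn_const (c := (0 : F))).congr (fun y hy => h2 y hy))
    isClosed_closedBall hS

lemma fderiv_zero_outside {ρ : ℝ} (hρ : 0 < ρ) (g : E → F) (hc : Continuous (fderiv ℝ g))
    (h : ∀ x, ρ ≤ ‖x‖ → g x = 0) (x : E) (hx : ρ ≤ ‖x‖) : fderiv ℝ g x = 0 := by
  have hcl : IsClosed {x | fderiv ℝ g x = 0} := isClosed_eq hc continuous_const
  have hsub : (closedBall (0 : E) ρ)ᶜ ⊆ {x | fderiv ℝ g x = 0} := by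
    intro z hz
    have : g =ᶠ[nhds z] fun _ => 0 := by
      filter_upwards [isClosed_closedBall.isOpen_compl.mem_nhds hz] with y hy
      exact h y (le_of_lt (by simpa using hy))
    simp [this.fderiv_eq]
  have := closure_minimal hsub hcl
  rw [closure_compl, interior_closedBall _ hρ.ne'] at this
  exact this (by simpa using hx)

lemma norm_multi_le {T : ContinuousMultilinearMap ℝ (fun _ : Fin 2 => E) F}
    {S : E →L[ℝ] E →L[ℝ] F} (h : ∀ m, T m = S (m 0) (m 1)) : ‖T‖ = ‖S‖ := by
  apply le_antisymm
  · refine ContinuousMultilinearMap.opNorm_le_bound (norm_nonneg S) fun m => ?_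
    rw [h, Fin.prod_univ_two, ← mul_assoc]
    exact S.le_opNorm₂ _ _
  · refine ContinuousLinearMap.opNorm_le_bound₂ _ (norm_nonneg _) fun v w => ?_
    have := T.le_opNorm ![v, w]
    rw [h, Fin.prod_univ_two] at this
    simpa [mul_assoc] using this

lemma smul_bd {a : ℝ} {b : F} {A B : ℝ} (ha : |a| ≤ A) (hb : ‖b‖ ≤ B) : ‖a • b‖ ≤ A * B := by
  rw [norm_smul, Real.norm_eq_abs]
  exact mul_le_mul ha hb (norm_nonneg _) ((abs_nonneg _).trans ha)

lemma smul_diff_bd {a a' : ℝ} {b b' : F} {A B A' B' : ℝ} (haa : |a - a'| ≤ A') (hb : ‖b‖ ≤ B)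
    (ha : |a'| ≤ A) (hbb : ‖b - b'‖ ≤ B') : ‖a • b - a' • b'‖ ≤ A' * B + A * B' := by
  have : a • b - a' • b' = (a - a') • b + a' • (b - b') := by module
  rw [this]
  exact (norm_add_le _ _).trans (add_le_add (smul_bd haa hb) (smul_bd ha hbb))

lemma ap1 {G : Type*} [NormedAddCommGroup G] [NormedSpace ℝ G] {T : E →L[ℝ] G} {C : ℝ}
    (h : ‖T‖ ≤ C) (v : E) : ‖T v‖ ≤ C * ‖v‖ := T.le_of_opNorm_le h v

lemma ap2 {G : Type*} [NormedAddCommGroup G] [NormedSpace ℝ G] {T : E →L[ℝ] E →L[ℝ] G} {C : ℝ}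
    (h : ‖T‖ ≤ C) (v w : E) : ‖T v w‖ ≤ C * ‖v‖ * ‖w‖ :=
  T.le_of_opNorm₂_le_of_le h le_rfl le_rfl

lemma core_bounds (u : E → ℝ) (u1 : E → E →L[ℝ] ℝ) (u2 : E → E →L[ℝ] E →L[ℝ] ℝ)
    (f : E → F) (f1 : E → E →L[ℝ] F) (f2 : E → E →L[ℝ] E →L[ℝ] F) (x y : E)
    (ρ Cu M L δ δa : ℝ) (hρ0 : 0 < ρ) (hCu : 1 ≤ Cu) (hM : 0 < M) (hL : 0 ≤ L)
    (hδ : 0 ≤ δ) (hδa : δ ≤ δa)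
    (hu : ∀ z, |u z| ≤ 1) (hu1 : ∀ z, ‖u1 z‖ ≤ Cu / ρ) (hu2 : ∀ z, ‖u2 z‖ ≤ Cu / ρ ^ 2)
    (hf : ‖f x‖ ≤ M * ρ ^ 2) (hf1 : ‖f1 x‖ ≤ M * ρ) (hf2 : ‖f2 x‖ ≤ M)
    (du : |u x - u y| ≤ Cu / ρ * δ) (du1 : ‖u1 x - u1 y‖ ≤ Cu / ρ ^ 2 * δ)
    (du2 : ‖u2 x - u2 y‖ ≤ Cu / ρ ^ 3 * δ)
    (df : ‖f x - f y‖ ≤ M * ρ * δ) (df1 : ‖f1 x - f1 y‖ ≤ M * δ)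
    (df2 : ‖f2 x - f2 y‖ ≤ L * δa) :
    ‖cutD1 u u1 f f1 x‖ ≤ (3 * Cu + 1) * M * ρ ∧
    ‖cutD2 u u1 u2 f f1 f2 x‖ ≤ (3 * Cu + 1) * M ∧
    ‖cutD2 u u1 u2 f f1 f2 x - cutD2 u u1 u2 f f1 f2 y‖ ≤ (7 * Cu * M / ρ + L) * δa := by
  refine ⟨?_, ?_, ?_⟩
  · refine ContinuousLinearMap.opNorm_le_bound _ (by positivity) fun v => ?_
    have e : cutD1 u u1 f f1 x v = u x • f1 x v + u1 x v • f x := by simp [cutD1]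
    rw [e]
    have a := smul_bd (hu x) (ap1 hf1 v)
    have b := smul_bd (ap1 (hu1 x) v) hf
    refine (norm_add_le _ _).trans ((add_le_add a b).trans ?_)
    have : 1 * (M * ρ * ‖v‖) + Cu / ρ * ‖v‖ * (M * ρ ^ 2) = (Cu + 1) * (M * ρ * ‖v‖) := by
      field_simp; ring
    rw [this]
    have : 0 ≤ M * ρ * ‖v‖ := by positivity
    nlinarith
  · refine ContinuousLinearMap.opNorm_le_bound₂ _ (by positivity) fun v w => ?_
    rw [cutD2_apply]
    have a := smul_bd (hu x) (ap2 hf2 v w)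
    have b := smul_bd (ap1 (hu1 x) v) (ap1 hf1 w)
    have c := smul_bd (ap1 (hu1 x) w) (ap1 hf1 v)
    have d := smul_bd (ap2 (hu2 x) v w) hf
    refine (norm_add_le _ _).trans ((add_le_add ((norm_add_le _ _).trans (add_le_add a b))
      ((norm_add_le _ _).trans (add_le_add c d))).trans (le_of_eq ?_))
    field_simp; ring
  · refine ContinuousLinearMap.opNorm_le_bound₂ _
      (mul_nonneg (by positivity) (hδ.trans hδa)) fun v w => ?_
    rw [sub_apply, sub_apply, cutD2_apply, cutD2_apply]
    have a := smul_diff_bd du (ap2 hf2 v w) (hu y) (ap2 df2 v w)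
    have b := smul_diff_bd (ap1 du1 v) (ap1 hf1 w) (ap1 (hu1 y) v) (ap1 df1 w)
    have c := smul_diff_bd (ap1 du1 w) (ap1 hf1 v) (ap1 (hu1 y) w) (ap1 df1 v)
    have d := smul_diff_bd (ap2 du2 v w) hf (ap2 (hu2 y) v w) df
    rw [add_sub_add_comm, add_sub_add_comm, add_sub_add_comm]
    refine (norm_add_le _ _).trans ((add_le_add ((norm_add_le _ _).trans (add_le_add a b))
      ((norm_add_le _ _).trans (add_le_add c d))).trans ?_)
    have : (7 * Cu * M / ρ + L) * δa * ‖v‖ * ‖w‖ =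
      7 * Cu * M / ρ * ‖v‖ * ‖w‖ * δa + L * δa * ‖v‖ * ‖w‖ := by ring
    rw [this]
    have h7 : 7 * Cu * M / ρ * ‖v‖ * ‖w‖ * δ ≤ 7 * Cu * M / ρ * ‖v‖ * ‖w‖ * δa :=
      mul_le_mul_of_nonneg_left hδa (by positivity)
    refine le_trans (le_of_eq ?_) (add_le_add_left h7 _)
    field_simp; ring

lemma third_lip (u : E → F) (hu : ContDiff ℝ 1 (fderiv ℝ (fderiv ℝ u))) {C : ℝ}
    (hC : ∀ z, ‖iteratedFDeriv ℝ 3 u z‖ ≤ C) (x y : E) :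
    ‖fderiv ℝ (fderiv ℝ u) x - fderiv ℝ (fderiv ℝ u) y‖ ≤ C * ‖x - y‖ := by
  have b : ∀ z, ‖fderiv ℝ (fderiv ℝ (fderiv ℝ u)) z‖ ≤ C := fun z => by
    have := hC z
    rw [← norm_iteratedFDeriv_fderiv, ← norm_iteratedFDeriv_fderiv,
      norm_iteratedFDeriv_one] at this
    exact this
  exact convex_univ.norm_image_sub_le_of_norm_hasFDerivWithin_le
      (fun z _ => (hu.differentiable (by norm_num) z).hasFDerivAt.hasFDerivWithinAt)
      (fun z _ => b z) (Set.mem_univ y) (Set.mem_univ x)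

end aux




/-- the cut-off extension F̃ of F = Λ + f is C², agrees with F on the ball
of radius ρ/2, and satisfies the stated global bounds on its first and second
derivatives and the Hölder bound on the second derivative. -/
theorem cutoff_extension
    (d : ℕ) (hd : 1 ≤ d) (α ρ Cu M L : ℝ)
    (hα : α ∈ Set.Icc (0 : ℝ) 1) (hρ0 : 0 < ρ) (hρ : ρ ≤ 1 / 2)
    (hCu : 1 ≤ Cu) (hM : 0 < M) (hL : 0 ≤ L)
    (u : EuclideanSpace ℝ (Fin d) → ℝ)
    (hu3 : ContDiff ℝ 3 u)
    (hu01 : ∀ x, 0 ≤ u x ∧ u x ≤ 1)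
    (huone : ∀ x, ‖x‖ ≤ ρ / 2 → u x = 1)
    (huzero : ∀ x, ρ ≤ ‖x‖ → u x = 0)
    (hud : ∀ x, ∀ r : ℕ, r = 1 ∨ r = 2 ∨ r = 3 → ρ ^ r * ‖iteratedFDeriv ℝ r u x‖ ≤ Cu)
    (Λ : EuclideanSpace ℝ (Fin d) →L[ℝ] EuclideanSpace ℝ (Fin d))
    (f : EuclideanSpace ℝ (Fin d) → EuclideanSpace ℝ (Fin d))
    (hf : ContDiffOn ℝ 2 f (closedBall 0 ρ))
    (hf0 : f 0 = 0)
    (hdf0 : fderivWithin ℝ f (closedBall 0 ρ) 0 = 0)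
    (hD2 : ∀ x ∈ closedBall (0 : EuclideanSpace ℝ (Fin d)) ρ,
      ‖iteratedFDerivWithin ℝ 2 (fun z => Λ z + f z) (closedBall 0 ρ) x‖ ≤ M)
    (hD2H : ∀ x ∈ closedBall (0 : EuclideanSpace ℝ (Fin d)) ρ,
      ∀ y ∈ closedBall (0 : EuclideanSpace ℝ (Fin d)) ρ,
      ‖iteratedFDerivWithin ℝ 2 (fun z => Λ z + f z) (closedBall 0 ρ) x
        - iteratedFDerivWithin ℝ 2 (fun z => Λ z + f z) (closedBall 0 ρ) y‖
        ≤ L * ‖x - y‖ ^ α) :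
    ContDiff ℝ 2 (fun z => Λ z + u z • f z) ∧
    (∀ x, ‖x‖ ≤ ρ / 2 → Λ x + u x • f x = Λ x + f x) ∧
    (∀ x, ‖fderiv ℝ (fun z => Λ z + u z • f z) x - Λ‖ ≤ (3 * Cu + 1) * M * ρ) ∧
    (∀ x, ‖iteratedFDeriv ℝ 2 (fun z => Λ z + u z • f z) x‖ ≤ (3 * Cu + 1) * M) ∧
    (∀ x y, ‖iteratedFDeriv ℝ 2 (fun z => Λ z + u z • f z) x
        - iteratedFDeriv ℝ 2 (fun z => Λ z + u z • f z) y‖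
      ≤ (7 * Cu * M / ρ + L) * ‖x - y‖ ^ α) := by
  classical
  have hdelta : ∀ x, x ∈ closedBall (0 : EuclideanSpace ℝ (Fin d)) ρ ↔ ‖x‖ ≤ ρ := by simp
  set B := closedBall (0 : EuclideanSpace ℝ (Fin d)) ρ with hB
  have hconv : Convex ℝ B := convex_closedBall _ _
  have hUD : UniqueDiffOn ℝ B := uniqueDiffOn_convex hconv
    ⟨0, by rw [hB, interior_closedBall _ hρ0.ne']; simpa using hρ0⟩
  have h0B : (0 : EuclideanSpace ℝ (Fin d)) ∈ B := by simpa [hB] using hρ0.le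
  -- the derivatives of `u`
  set u1 := fderiv ℝ u with hu1def
  set u2 := fderiv ℝ u1 with hu2def
  have cu1 : ContDiff ℝ 2 u1 := hu3.fderiv_right (by norm_num)
  have cu2 : ContDiff ℝ 1 u2 := cu1.fderiv_right (by norm_num)
  have Hu : ∀ x, HasFDerivAt u (u1 x) x :=
    fun x => (hu3.differentiable (by norm_num) x).hasFDerivAt
  have Hu1 : ∀ x, HasFDerivAt u1 (u2 x) x :=
    fun x => (cu1.differentiable (by norm_num) x).hasFDerivAt
  have bu : ∀ z, |u z| ≤ 1 := fun z => by
    rw [abs_of_nonneg (hu01 z).1]; exact (hu01 z).2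
  have bu1 : ∀ z, ‖u1 z‖ ≤ Cu / ρ := fun z => by
    have := hud z 1 (by simp)
    rw [norm_iteratedFDeriv_one] at this
    rw [le_div_iff₀ hρ0]; linarith
  have bu2 : ∀ z, ‖u2 z‖ ≤ Cu / ρ ^ 2 := fun z => by
    have := hud z 2 (by simp)
    rw [← norm_iteratedFDeriv_fderiv, norm_iteratedFDeriv_one] at this
    rw [le_div_iff₀ (by positivity), mul_comm]; exact this
  have du : ∀ x y, |u x - u y| ≤ Cu / ρ * ‖x - y‖ := fun x y =>
    convex_univ.norm_image_sub_le_of_norm_hasFDerivWithin_le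
      (fun z _ => (Hu z).hasFDerivWithinAt) (fun z _ => bu1 z) (Set.mem_univ y) (Set.mem_univ x)
  have du1 : ∀ x y, ‖u1 x - u1 y‖ ≤ Cu / ρ ^ 2 * ‖x - y‖ := fun x y =>
    convex_univ.norm_image_sub_le_of_norm_hasFDerivWithin_le
      (fun z _ => (Hu1 z).hasFDerivWithinAt) (fun z _ => bu2 z) (Set.mem_univ y) (Set.mem_univ x)
  have du2 : ∀ x y, ‖u2 x - u2 y‖ ≤ Cu / ρ ^ 3 * ‖x - y‖ :=
    third_lip u cu2 fun z => by
      rw [le_div_iff₀ (by positivity), mul_comm]; exact hud z 3 (by simp)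
  have zu1 : ∀ x, ρ ≤ ‖x‖ → u1 x = 0 := fderiv_zero_outside hρ0 u cu1.continuous huzero
  have zu2 : ∀ x, ρ ≤ ‖x‖ → u2 x = 0 := fderiv_zero_outside hρ0 u1 cu2.continuous zu1
  -- the derivatives of `f`
  set f1 := fderivWithin ℝ f B with hf1def
  set f2 := fderivWithin ℝ f1 B with hf2def
  have cf1 : ContDiffOn ℝ 1 f1 B := hf.fderivWithin hUD (by norm_num)
  have cf2 : ContDiffOn ℝ 0 f2 B := cf1.fderivWithin hUD (by norm_num)
  have Hf : ∀ x ∈ B, HasFDerivWithinAt f (f1 x) B x :=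
    fun x hx => (hf.differentiableOn (by norm_num) x hx).hasFDerivWithinAt
  have Hf1 : ∀ x ∈ B, HasFDerivWithinAt f1 (f2 x) B x :=
    fun x hx => (cf1.differentiableOn (by norm_num) x hx).hasFDerivWithinAt
  have hit : ∀ x ∈ B, ∀ m : Fin 2 → EuclideanSpace ℝ (Fin d),
      iteratedFDerivWithin ℝ 2 (fun z => Λ z + f z) B x m = f2 x (m 0) (m 1) := by
    intro x hx m
    rw [iteratedFDerivWithin_two_apply _ hUD hx]
    have e1 : ∀ z ∈ B, fderivWithin ℝ (fun z => Λ z + f z) B z = Λ + f1 z := fun z hz =>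
      (Λ.hasFDerivWithinAt.add (Hf z hz)).fderivWithin (hUD z hz)
    have e2 : fderivWithin ℝ (fderivWithin ℝ (fun z => Λ z + f z) B) B x = f2 x := by
      rw [fderivWithin_congr e1 (e1 x hx)]
      exact ((Hf1 x hx).const_add Λ).fderivWithin (hUD x hx)
    rw [e2]
  have bf2 : ∀ x ∈ B, ‖f2 x‖ ≤ M := fun x hx => by
    rw [← norm_multi_le (hit x hx)]; exact hD2 x hx
  have df2 : ∀ x ∈ B, ∀ y ∈ B, ‖f2 x - f2 y‖ ≤ L * ‖x - y‖ ^ α := fun x hx y hy => by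
    refine le_trans (le_of_eq ?_) (hD2H x hx y hy)
    refine (norm_multi_le fun m => ?_).symm
    rw [ContinuousMultilinearMap.sub_apply, hit x hx, hit y hy]; rfl
  have df1 : ∀ x ∈ B, ∀ y ∈ B, ‖f1 x - f1 y‖ ≤ M * ‖x - y‖ := fun x hx y hy =>
    hconv.norm_image_sub_le_of_norm_hasFDerivWithin_le Hf1 bf2 hy hx
  have bf1 : ∀ x ∈ B, ‖f1 x‖ ≤ M * ρ := fun x hx => by
    have := df1 x hx 0 h0B
    rw [hdf0, sub_zero, sub_zero] at this
    exact this.trans (mul_le_mul_of_nonneg_left ((hdelta x).1 hx) hM.le)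
  have df : ∀ x ∈ B, ∀ y ∈ B, ‖f x - f y‖ ≤ M * ρ * ‖x - y‖ := fun x hx y hy =>
    hconv.norm_image_sub_le_of_norm_hasFDerivWithin_le Hf bf1 hy hx
  have bf : ∀ x ∈ B, ‖f x‖ ≤ M * ρ ^ 2 := fun x hx => by
    have := df x hx 0 h0B
    rw [hf0, sub_zero, sub_zero] at this
    refine this.trans ?_
    rw [pow_two, ← mul_assoc]
    exact mul_le_mul_of_nonneg_left ((hdelta x).1 hx) (by positivity)
  -- the derivatives of the product
  set h1 := cutD1 u u1 f f1 with hh1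
  set h2 := cutD2 u u1 u2 f f1 f2 with hh2
  have zh1 : ∀ x, ρ ≤ ‖x‖ → h1 x = 0 := fun x hx => by
    ext1 v; simp [hh1, cutD1, huzero x hx, zu1 x hx]
  have zh2 : ∀ x, ρ ≤ ‖x‖ → h2 x = 0 := fun x hx => by
    ext1 v; ext1 w; rw [hh2, cutD2_apply]; simp [huzero x hx, zu1 x hx, zu2 x hx]
  have Hh : ∀ x, HasFDerivAt (fun z => u z • f z) (h1 x) x :=
    hasFDerivAt_glue (ρ := ρ) _ _ (fun x hx => (Hu x).hasFDerivWithinAt.fun_smul (Hf x hx))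
      (fun x hx => by simp [huzero x hx]) zh1
  have Hh1 : ∀ x, HasFDerivAt h1 (h2 x) x :=
    hasFDerivAt_glue (ρ := ρ) _ _ (fun x hx =>
      ((Hu x).hasFDerivWithinAt.fun_smul (Hf1 x hx)).add
        ((ContinuousLinearMap.smulRightL ℝ _ _).hasFDerivWithinAt_of_bilinear
          (Hu1 x).hasFDerivWithinAt (Hf x hx))) zh1 zh2
  have ch2 : Continuous h2 := by
    refine continuous_glue (ρ := ρ) _ ?_ zh2
    have a0 := hu3.continuous.continuousOn (s := B)
    have a1 := cu1.continuous.continuousOn (s := B)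
    have a2 := cu2.continuous.continuousOn (s := B)
    have b0 := hf.continuousOn
    have b1 := cf1.continuousOn
    have b2 := cf2.continuousOn
    have c1 : ContinuousOn (fun x => (u1 x).smulRight (f1 x)) B :=
      ((ContinuousLinearMap.smulRightL ℝ _ _).continuous.comp_continuousOn a1).clm_apply b1
    have c2 := (((ContinuousLinearMap.precompR (EuclideanSpace ℝ (Fin d))
      (ContinuousLinearMap.smulRightL ℝ (EuclideanSpace ℝ (Fin d))
        (EuclideanSpace ℝ (Fin d)))).continuous.comp_continuousOn a1).clm_apply b1)
    have c3 := (((ContinuousLinearMap.precompL (EuclideanSpace ℝ (Fin d))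
      (ContinuousLinearMap.smulRightL ℝ (EuclideanSpace ℝ (Fin d))
        (EuclideanSpace ℝ (Fin d)))).continuous.comp_continuousOn a2).clm_apply b0)
    exact ((a0.smul b2).add c1).add (c2.add c3)
  have HF : ∀ x, HasFDerivAt (fun z => Λ z + u z • f z) (Λ + h1 x) x :=
    fun x => Λ.hasFDerivAt.add (Hh x)
  have HF1 : ∀ x, HasFDerivAt (fun z => Λ + h1 z) (h2 x) x := fun x => (Hh1 x).const_add Λ
  have eF : fderiv ℝ (fun z => Λ z + u z • f z) = fun z => Λ + h1 z :=
    funext fun x => (HF x).fderiv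
  have hit2 : ∀ x, ∀ m : Fin 2 → EuclideanSpace ℝ (Fin d),
      iteratedFDeriv ℝ 2 (fun z => Λ z + u z • f z) x m = h2 x (m 0) (m 1) := by
    intro x m
    rw [iteratedFDeriv_two_apply, eF, (HF1 x).fderiv]
  have hitd : ∀ x y, ‖iteratedFDeriv ℝ 2 (fun z => Λ z + u z • f z) x
        - iteratedFDeriv ℝ 2 (fun z => Λ z + u z • f z) y‖ = ‖h2 x - h2 y‖ := by
    intro x y
    refine norm_multi_le fun m => ?_
    rw [ContinuousMultilinearMap.sub_apply, hit2 x, hit2 y]; rfl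
  have core : ∀ x ∈ B, ∀ y ∈ B, ‖h1 x‖ ≤ (3 * Cu + 1) * M * ρ ∧ ‖h2 x‖ ≤ (3 * Cu + 1) * M ∧
      ‖h2 x - h2 y‖ ≤ (7 * Cu * M / ρ + L) * ‖x - y‖ ^ α := by
    intro x hx y hy
    have hle1 : ‖x - y‖ ≤ 1 := by
      have := norm_sub_le x y
      have := (hdelta x).1 hx
      have := (hdelta y).1 hy
      linarith
    have hle : ‖x - y‖ ≤ ‖x - y‖ ^ α := by
      rcases eq_or_lt_of_le (norm_nonneg (x - y)) with h | h
      · rw [← h]; exact Real.rpow_nonneg le_rfl _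
      · have := Real.rpow_le_rpow_of_exponent_ge h hle1 hα.2
        rwa [Real.rpow_one] at this
    exact core_bounds u u1 u2 f f1 f2 x y ρ Cu M L _ _ hρ0 hCu hM hL (norm_nonneg _) hle bu bu1 bu2
      (bf x hx) (bf1 x hx) (bf2 x hx) (du x y) (du1 x y) (du2 x y) (df x hx y hy)
      (df1 x hx y hy) (df2 x hx y hy)
  have hK : 0 ≤ 7 * Cu * M / ρ + L := by positivity
  -- one point inside the ball, the other outside
  have mixed : ∀ x y, ‖x‖ ≤ ρ → ρ ≤ ‖y‖ →
      ‖h2 x - h2 y‖ ≤ (7 * Cu * M / ρ + L) * ‖x - y‖ ^ α := by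
    intro x y hx hy
    obtain ⟨t, ht, hzt⟩ : ∃ t ∈ Set.Icc (0 : ℝ) 1, ‖x + t • (y - x)‖ = ρ := by
      have hc : ContinuousOn (fun t : ℝ => ‖x + t • (y - x)‖) (Set.Icc 0 1) := by fun_prop
      have := intermediate_value_Icc zero_le_one hc
      exact this ⟨by simpa using hx, by simpa using hy⟩
    have hxz : ‖x - (x + t • (y - x))‖ ≤ ‖x - y‖ := by
      have : x - (x + t • (y - x)) = t • (x - y) := by module
      rw [this, norm_smul, Real.norm_eq_abs, abs_of_nonneg ht.1]
      exact mul_le_of_le_one_left (norm_nonneg _) ht.2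
    have := (core x ((hdelta x).2 hx) _ ((hdelta _).2 hzt.le)).2.2
    rw [zh2 _ hzt.ge] at this
    rw [zh2 y hy]
    exact this.trans (mul_le_mul_of_nonneg_left
      (Real.rpow_le_rpow (norm_nonneg _) hxz hα.1) hK)
  refine ⟨?_, ?_, ?_, ?_, ?_⟩
  · have c1 : ContDiff ℝ 1 (fun z => Λ + h1 z) := contDiff_one_iff_hasFDerivAt.2 ⟨h2, ch2, HF1⟩
    have := (contDiff_succ_iff_hasFDerivAt (n := 1) (f := fun z => Λ z + u z • f z)).2
      ⟨_, by exact_mod_cast c1, HF⟩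
    exact_mod_cast this
  · intro x hx
    rw [huone x hx, one_smul]
  · intro x
    rw [eF, add_sub_cancel_left]
    rcases le_total ‖x‖ ρ with hx | hx
    · exact (core x ((hdelta x).2 hx) x ((hdelta x).2 hx)).1
    · rw [zh1 x hx, norm_zero]; positivity
  · intro x
    rw [norm_multi_le (hit2 x)]
    rcases le_total ‖x‖ ρ with hx | hx
    · exact (core x ((hdelta x).2 hx) x ((hdelta x).2 hx)).2.1
    · rw [zh2 x hx, norm_zero]; positivity
  · intro x y
    rw [hitd]
    rcases le_total ‖x‖ ρ with hx | hx
    · rcases le_total ‖y‖ ρ with hy | hy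
      · exact (core x ((hdelta x).2 hx) y ((hdelta y).2 hy)).2.2
      · exact mixed x y hx hy
    · rcases le_total ‖y‖ ρ with hy | hy
      · rw [norm_sub_rev, norm_sub_rev x y]; exact mixed y x hy hx
      · rw [zh2 x hx, zh2 y hy, sub_zero, norm_zero]; positivity
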